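/- Let X ∈ ℝ^{n×d}, Y ∈ ℝ^{m×d}, p ∈ Σ_n, q ∈ Σ_m. If PW₂(μ_X, μ_Y) = 0, then there exists P ∈ O(d) such that the discrete measures Σ_{i=1}^n p_i δ_{x_i} and Σ_{j=1}^m q_j δ_{y_j P} are equal as measures on ℝ^d. -/

import Mathlib

open Matrix BigOperators

noncomputable section

/-- The probability simplex `Σ_n`. -/
def probSimplex (n : ℕ) : Set (Fin n → ℝ) :=
  {p | (∀ i, 0 ≤ p i) ∧ ∑ i, p i = 1}

/-- The set of admissible transport plans `Π(p, q)`. -/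
def transportPlans {n m : ℕ} (p : Fin n → ℝ) (q : Fin m → ℝ) :
    Set (Matrix (Fin n) (Fin m) ℝ) :=
  {Γ | (∀ i j, 0 ≤ Γ i j) ∧ (∀ i, ∑ j, Γ i j = p i) ∧ (∀ j, ∑ i, Γ i j = q j)}

/-- Frobenius inner product `⟨A, B⟩_F = trace(Bᵀ A)`. -/
def frob {n m : ℕ} (A B : Matrix (Fin n) (Fin m) ℝ) : ℝ :=
  (Bᵀ * A).trace

/-- Cost matrix `(C_P(X,Y))_{ij} = ‖x_i − y_j P‖₂²`. -/
def costP {n m d : ℕ} (P : Matrix (Fin d) (Fin d) ℝ)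
    (X : Matrix (Fin n) (Fin d) ℝ) (Y : Matrix (Fin m) (Fin d) ℝ) :
    Matrix (Fin n) (Fin m) ℝ :=
  Matrix.of fun i j => ∑ k, (X i k - (Y * P) j k) ^ 2

/-- Squared Procrustes–Wasserstein distance. -/
def PWsq {n m d : ℕ} (X : Matrix (Fin n) (Fin d) ℝ) (p : Fin n → ℝ)
    (Y : Matrix (Fin m) (Fin d) ℝ) (q : Fin m → ℝ) : ℝ :=
  sInf {c | ∃ P ∈ Matrix.orthogonalGroup (Fin d) ℝ,
    ∃ Γ ∈ transportPlans p q, c = frob (costP P X Y) Γ}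

/-- Procrustes–Wasserstein distance `PW₂`. -/
def PW2dist {n m d : ℕ} (X : Matrix (Fin n) (Fin d) ℝ) (p : Fin n → ℝ)
    (Y : Matrix (Fin m) (Fin d) ℝ) (q : Fin m → ℝ) : ℝ :=
  Real.sqrt (PWsq X p Y q)

/-- Squared discrete 2-Wasserstein distance. -/
def W2sq {n m d : ℕ} (X : Matrix (Fin n) (Fin d) ℝ) (p : Fin n → ℝ)
    (Y : Matrix (Fin m) (Fin d) ℝ) (q : Fin m → ℝ) : ℝ :=
  sInf {c | ∃ Γ ∈ transportPlans p q, c = frob (costP 1 X Y) Γ}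

/-- Discrete 2-Wasserstein distance `W₂`. -/
def W2dist {n m d : ℕ} (X : Matrix (Fin n) (Fin d) ℝ) (p : Fin n → ℝ)
    (Y : Matrix (Fin m) (Fin d) ℝ) (q : Fin m → ℝ) : ℝ :=
  Real.sqrt (W2sq X p Y q)

open MeasureTheory

/-- The set of matrices with entries in a fixed interval is compact. -/
theorem isCompact_matrix_Icc {n m : ℕ} (a b : ℝ) :
    IsCompact {A : Matrix (Fin n) (Fin m) ℝ | ∀ i j, A i j ∈ Set.Icc a b} := by
  have h : {A : Matrix (Fin n) (Fin m) ℝ | ∀ i j, A i j ∈ Set.Icc a b} =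
      Set.univ.pi fun _ => Set.univ.pi fun _ => Set.Icc a b :=
    Set.ext fun A => ⟨fun hA i _ j _ => hA i j, fun hA i j => hA i trivial j trivial⟩
  rw [h]
  exact isCompact_univ_pi fun _ => isCompact_univ_pi fun _ => isCompact_Icc

theorem isCompact_orthogonalGroup (d : ℕ) :
    IsCompact (Matrix.orthogonalGroup (Fin d) ℝ : Set (Matrix (Fin d) (Fin d) ℝ)) := by
  refine (isCompact_matrix_Icc (-1) 1).of_isClosed_subset ?_ fun A hA i j =>
    abs_le.mp (entry_norm_bound_of_unitary hA i j)
  have h : (Matrix.orthogonalGroup (Fin d) ℝ : Set (Matrix (Fin d) (Fin d) ℝ)) =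
      {A | A * Aᵀ = 1} := by
    ext A
    exact Matrix.mem_orthogonalGroup_iff (Fin d) ℝ
  rw [h]
  exact isClosed_eq (by fun_prop) continuous_const

theorem isCompact_transportPlans {n m : ℕ} (p : Fin n → ℝ) {q : Fin m → ℝ}
    (hq : q ∈ probSimplex m) : IsCompact (transportPlans p q) := by
  refine (isCompact_matrix_Icc 0 1).of_isClosed_subset ?_ fun Γ hΓ i j => ⟨hΓ.1 i j, ?_⟩
  · simp only [transportPlans, Set.ofPred_and, Set.ofPred_forall]
    refine .inter (isClosed_iInter fun i => isClosed_iInter fun j => ?_)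
      (.inter (isClosed_iInter fun i => ?_) (isClosed_iInter fun j => ?_))
    · exact isClosed_le (by fun_prop) (by fun_prop)
    · exact isClosed_eq (by fun_prop) (by fun_prop)
    · exact isClosed_eq (by fun_prop) (by fun_prop)
  · calc Γ i j ≤ ∑ i, Γ i j :=
          Finset.single_le_sum (f := fun i => Γ i j) (fun i _ => hΓ.1 i j) (Finset.mem_univ i)
      _ = q j := hΓ.2.2 j
      _ ≤ ∑ j, q j := Finset.single_le_sum (fun j _ => hq.1 j) (Finset.mem_univ j)
      _ = 1 := hq.2

/-- The product plan is admissible. -/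
theorem vecMulVec_mem_transportPlans {n m : ℕ} {p : Fin n → ℝ} {q : Fin m → ℝ}
    (hp : p ∈ probSimplex n) (hq : q ∈ probSimplex m) :
    Matrix.vecMulVec p q ∈ transportPlans p q := by
  refine ⟨fun i j => mul_nonneg (hp.1 i) (hq.1 j), fun i => ?_, fun j => ?_⟩
  · simp [Matrix.vecMulVec_apply, ← Finset.mul_sum, hq.2]
  · simp [Matrix.vecMulVec_apply, ← Finset.sum_mul, hp.2]

theorem frob_eq_sum {n m : ℕ} (A B : Matrix (Fin n) (Fin m) ℝ) :
    frob A B = ∑ j, ∑ i, B i j * A i j := by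
  simp [frob, Matrix.trace, Matrix.mul_apply]

theorem costP_nonneg {n m d : ℕ} (P : Matrix (Fin d) (Fin d) ℝ)
    (X : Matrix (Fin n) (Fin d) ℝ) (Y : Matrix (Fin m) (Fin d) ℝ) (i : Fin n) (j : Fin m) :
    0 ≤ costP P X Y i j := by
  rw [costP, Matrix.of_apply]
  exact Finset.sum_nonneg fun _ _ => sq_nonneg _

theorem costP_eq_zero_iff {n m d : ℕ} {P : Matrix (Fin d) (Fin d) ℝ}
    {X : Matrix (Fin n) (Fin d) ℝ} {Y : Matrix (Fin m) (Fin d) ℝ} {i : Fin n} {j : Fin m} :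
    costP P X Y i j = 0 ↔ X i = (Y * P) j := by
  rw [costP, Matrix.of_apply, Finset.sum_eq_zero_iff_of_nonneg fun _ _ => sq_nonneg _, funext_iff]
  simp [sub_eq_zero]

theorem frob_costP_nonneg {n m d : ℕ} (P : Matrix (Fin d) (Fin d) ℝ)
    (X : Matrix (Fin n) (Fin d) ℝ) (Y : Matrix (Fin m) (Fin d) ℝ)
    {p : Fin n → ℝ} {q : Fin m → ℝ} {Γ : Matrix (Fin n) (Fin m) ℝ}
    (hΓ : Γ ∈ transportPlans p q) : 0 ≤ frob (costP P X Y) Γ := by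
  rw [frob_eq_sum]
  exact Finset.sum_nonneg fun j _ => Finset.sum_nonneg fun i _ =>
    mul_nonneg (hΓ.1 i j) (costP_nonneg P X Y i j)

theorem continuous_frob_costP {n m d : ℕ} (X : Matrix (Fin n) (Fin d) ℝ)
    (Y : Matrix (Fin m) (Fin d) ℝ) :
    Continuous fun z : Matrix (Fin d) (Fin d) ℝ × Matrix (Fin n) (Fin m) ℝ =>
      frob (costP z.1 X Y) z.2 := by
  simp only [frob_eq_sum, costP, Matrix.of_apply, Matrix.mul_apply]
  fun_prop

/-- The infimum defining the squared Procrustes–Wasserstein distance is attained. -/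
theorem exists_frob_costP_eq_PWsq {n m d : ℕ} (X : Matrix (Fin n) (Fin d) ℝ)
    (Y : Matrix (Fin m) (Fin d) ℝ) {p : Fin n → ℝ} {q : Fin m → ℝ}
    (hp : p ∈ probSimplex n) (hq : q ∈ probSimplex m) :
    ∃ P ∈ Matrix.orthogonalGroup (Fin d) ℝ, ∃ Γ ∈ transportPlans p q,
      PWsq X p Y q = frob (costP P X Y) Γ := by
  have hK := ((isCompact_orthogonalGroup d).prod (isCompact_transportPlans p hq)).image
    (continuous_frob_costP X Y)
  have hS : {c | ∃ P ∈ Matrix.orthogonalGroup (Fin d) ℝ,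
      ∃ Γ ∈ transportPlans p q, c = frob (costP P X Y) Γ} =
      (fun z : Matrix (Fin d) (Fin d) ℝ × Matrix (Fin n) (Fin m) ℝ => frob (costP z.1 X Y) z.2) ''
        ((Matrix.orthogonalGroup (Fin d) ℝ : Set (Matrix (Fin d) (Fin d) ℝ)) ×ˢ
          transportPlans p q) := by
    ext c
    constructor
    · rintro ⟨P, hP, Γ, hΓ, rfl⟩
      exact ⟨(P, Γ), ⟨hP, hΓ⟩, rfl⟩
    · rintro ⟨⟨P, Γ⟩, ⟨hP, hΓ⟩, rfl⟩
      exact ⟨P, hP, Γ, hΓ, rfl⟩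
  rw [← hS] at hK
  exact hK.sInf_mem ⟨_, 1, one_mem _, _, vecMulVec_mem_transportPlans hp hq, rfl⟩

/-- A plan supported on pairs of coinciding points forces the two discrete measures to agree. -/
theorem sum_smul_dirac_eq_of_transportPlan {n m : ℕ} {E : Type*} [MeasurableSpace E]
    {x : Fin n → E} {y : Fin m → E} {p : Fin n → ℝ} {q : Fin m → ℝ}
    {Γ : Matrix (Fin n) (Fin m) ℝ} (hΓ : Γ ∈ transportPlans p q)
    (h : ∀ i j, Γ i j = 0 ∨ x i = y j) :
    ∑ i, ENNReal.ofReal (p i) • Measure.dirac (x i) =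
      ∑ j, ENNReal.ofReal (q j) • Measure.dirac (y j) := by
  obtain ⟨h0, hrow, hcol⟩ := hΓ
  calc ∑ i, ENNReal.ofReal (p i) • Measure.dirac (x i)
      = ∑ i, ∑ j, ENNReal.ofReal (Γ i j) • Measure.dirac (x i) := by
        refine Finset.sum_congr rfl fun i _ => ?_
        rw [← hrow i, ENNReal.ofReal_sum_of_nonneg fun j _ => h0 i j, Finset.sum_smul]
    _ = ∑ i, ∑ j, ENNReal.ofReal (Γ i j) • Measure.dirac (y j) := by
        refine Finset.sum_congr rfl fun i _ => Finset.sum_congr rfl fun j _ => ?_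
        rcases h i j with h | h <;> simp [h]
    _ = ∑ j, ∑ i, ENNReal.ofReal (Γ i j) • Measure.dirac (y j) := Finset.sum_comm
    _ = ∑ j, ENNReal.ofReal (q j) • Measure.dirac (y j) := by
        refine Finset.sum_congr rfl fun j _ => ?_
        rw [← hcol j, ENNReal.ofReal_sum_of_nonneg fun i _ => h0 i j, Finset.sum_smul]

/-- if `PW₂(μ_X, μ_Y) = 0` then there is `P ∈ O(d)` such that
`Σ_i p_i δ_{x_i} = Σ_j q_j δ_{y_j P}` as measures on `ℝ^d`. -/
theorem measures_eq_of_pw_eq_zero {n m d : ℕ}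
    (X : Matrix (Fin n) (Fin d) ℝ) (Y : Matrix (Fin m) (Fin d) ℝ)
    (p : Fin n → ℝ) (q : Fin m → ℝ)
    (hp : p ∈ probSimplex n) (hq : q ∈ probSimplex m)
    (h : PW2dist X p Y q = 0) :
    ∃ P ∈ Matrix.orthogonalGroup (Fin d) ℝ,
      (∑ i, ENNReal.ofReal (p i) • Measure.dirac (X i)) =
        (∑ j, ENNReal.ofReal (q j) • Measure.dirac ((Y * P) j)) := by
  obtain ⟨P, hP, Γ, hΓ, hPΓ⟩ := exists_frob_costP_eq_PWsq X Y hp hq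
  refine ⟨P, hP, sum_smul_dirac_eq_of_transportPlan hΓ fun i j => ?_⟩
  have hzero : frob (costP P X Y) Γ = 0 :=
    le_antisymm (hPΓ ▸ Real.sqrt_eq_zero'.mp h) (frob_costP_nonneg P X Y hΓ)
  have hterm : ∀ i j, 0 ≤ Γ i j * costP P X Y i j := fun i j =>
    mul_nonneg (hΓ.1 i j) (costP_nonneg P X Y i j)
  rw [frob_eq_sum, Finset.sum_eq_zero_iff_of_nonneg
    fun j _ => Finset.sum_nonneg fun i _ => hterm i j] at hzero
  have hij := (Finset.sum_eq_zero_iff_of_nonneg fun i _ => hterm i j).mp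
    (hzero j (Finset.mem_univ j)) i (Finset.mem_univ i)
  exact (mul_eq_zero.mp hij).imp_right costP_eq_zero_iff.mp
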